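/- (The development map carries the GNLS flow to the MNLS flow.) Let a = (i/2)·diag(I_k, −I_{n−k}) and let g : ℝ² → U(n) be a smooth map such that u := g⁻¹g_x takes values in u(n)_a^⊥, such that for each t the maps x ↦ u(x,t) and x ↦ (g⁻¹g_t)(x,t) are of Schwartz class, and such that g(x,t) → I and (g⁻¹g_t)(x,t) → 0 as x → −∞ for each t. Set γ := g a g⁻¹ and let q(x,t) denote the upper-right k×(n−k) block of u(x,t). If γ satisfies γ_t = [γ, γ_xx] identically, then q satisfies the matrix nonlinear Schrödinger equation q_t = i(q_xx + 2 q q* q). -/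

import Mathlib

open Matrix Filter

attribute [local instance] Matrix.normedAddCommGroup Matrix.normedSpace

/-- A map of `ℝ` into a normed space is of Schwartz class if it is (the underlying function
of) a Schwartz map. -/
def IsSchwartz {E : Type*} [NormedAddCommGroup E] [NormedSpace ℝ E] (f : ℝ → E) : Prop :=
  ∃ φ : SchwartzMap ℝ E, ⇑φ = f

/-- The centralizer `u(n)_a = {y ∈ u(n) : [y,a] = 0}` of `a` in `u(n)`. -/
def uCent {ι : Type*} [Fintype ι] (a : Matrix ι ι ℂ) : Set (Matrix ι ι ℂ) :=
  {y | yᴴ = -y ∧ y * a = a * y}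

/-- The orthogonal complement `u(n)_a^⊥` of `u(n)_a` in `u(n)` w.r.t. `⟨x,y⟩ = −tr(xy)`. -/
def uPerp {ι : Type*} [Fintype ι] (a : Matrix ι ι ℂ) : Set (Matrix ι ι ℂ) :=
  {y | yᴴ = -y ∧ ∀ z ∈ uCent a, -(y * z).trace = 0}

theorem ContDiff.exists_partials {E : Type*} [NormedAddCommGroup E] [NormedSpace ℝ E]
    {F : ℝ × ℝ → E} (hF : ContDiff ℝ (⊤ : ℕ∞) F) :
    ∃ Fx Ft Fxt : ℝ × ℝ → E, ContDiff ℝ (⊤ : ℕ∞) Fx ∧ ContDiff ℝ (⊤ : ℕ∞) Ft ∧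
      (∀ x t, HasDerivAt (fun y => F (y, t)) (Fx (x, t)) x) ∧
      (∀ x t, HasDerivAt (fun s => F (x, s)) (Ft (x, t)) t) ∧
      (∀ x t, HasDerivAt (fun s => Fx (x, s)) (Fxt (x, t)) t) ∧
      (∀ x t, HasDerivAt (fun y => Ft (y, t)) (Fxt (x, t)) x) := by
  have hfst {H : ℝ × ℝ → E} (hH : ContDiff ℝ (⊤ : ℕ∞) H) (x t : ℝ) :
      HasDerivAt (fun y => H (y, t)) (fderiv ℝ H (x, t) (1, 0)) x :=
    ((hH.differentiable (by simp)).differentiableAt.hasFDerivAt (x := (x, t))).comp_hasDerivAt x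
      ((hasDerivAt_id x).prodMk (hasDerivAt_const x t))
  have hsnd {H : ℝ × ℝ → E} (hH : ContDiff ℝ (⊤ : ℕ∞) H) (x t : ℝ) :
      HasDerivAt (fun s => H (x, s)) (fderiv ℝ H (x, t) (0, 1)) t :=
    ((hH.differentiable (by simp)).differentiableAt.hasFDerivAt (x := (x, t))).comp_hasDerivAt t
      ((hasDerivAt_const t x).prodMk (hasDerivAt_id t))
  have hd : ContDiff ℝ (⊤ : ℕ∞) (fderiv ℝ F) := hF.fderiv_right (by simp)
  have hv (v : ℝ × ℝ) : ContDiff ℝ (⊤ : ℕ∞) fun p => fderiv ℝ F p v :=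
    hd.clm_apply contDiff_const
  have hcomm (p : ℝ × ℝ) : fderiv ℝ (fun z => fderiv ℝ F z (1, 0)) p (0, 1) =
      fderiv ℝ (fun z => fderiv ℝ F z (0, 1)) p (1, 0) := by
    have hdp : DifferentiableAt ℝ (fderiv ℝ F) p := (hd.differentiable (by simp)).differentiableAt
    have hs : IsSymmSndFDerivAt ℝ F p := hF.contDiffAt.isSymmSndFDerivAt
      (by simpa using
        (WithTop.coe_le_coe.mpr le_top : ((2 : ℕ∞) : WithTop ℕ∞) ≤ ((⊤ : ℕ∞) : WithTop ℕ∞)))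
    rw [fderiv_clm_apply hdp (differentiableAt_const _),
      fderiv_clm_apply hdp (differentiableAt_const _)]
    simpa using hs.eq (0, 1) (1, 0)
  refine ⟨fun p => fderiv ℝ F p (1, 0), fun p => fderiv ℝ F p (0, 1),
    fun p => fderiv ℝ (fun z => fderiv ℝ F z (1, 0)) p (0, 1), hv _, hv _, hfst hF, hsnd hF,
    hsnd (hv _), fun x t => ?_⟩
  beta_reduce
  rw [hcomm]
  exact hfst (hv _) x t

/-- A function with vanishing derivative and limit `0` at `-∞` vanishes. -/
theorem eq_zero_of_hasDerivAt_zero_of_tendsto_atBot {E : Type*} [NormedAddCommGroup E]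
    [NormedSpace ℝ E] {f : ℝ → E} (hf : ∀ x, HasDerivAt f 0 x)
    (hlim : Tendsto f atBot (nhds 0)) (x : ℝ) : f x = 0 := by
  have hc : f = fun _ => f x := funext fun y =>
    is_const_of_deriv_eq_zero (fun z => (hf z).differentiableAt) (fun z => (hf z).deriv) y x
  rw [hc] at hlim
  exact tendsto_const_nhds_iff.mp hlim

theorem IsSchwartz.tendsto_atBot {E : Type*} [NormedAddCommGroup E] [NormedSpace ℝ E]
    {f : ℝ → E} (hf : IsSchwartz f) : Tendsto f atBot (nhds 0) := by
  obtain ⟨φ, rfl⟩ := hf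
  exact φ.tendsto_cocompact.mono_left atBot_le_cocompact

section MatrixCalculus

variable {l m n : Type*} [Fintype l] [Fintype m] [Fintype n]

theorem Matrix.hasDerivAt_iff {l m : Type*} [Fintype m]
    {A : ℝ → Matrix l m ℂ} {A' : Matrix l m ℂ} {x : ℝ} :
    HasDerivAt A A' x ↔ ∀ i j, HasDerivAt (fun y => A y i j) (A' i j) x := by
  refine (hasDerivAt_pi (E' := fun _ => m → ℂ)).trans (forall_congr' fun i => ?_)
  exact hasDerivAt_pi

theorem Matrix.contDiff_iff {E : Type*} [NormedAddCommGroup E] [NormedSpace ℝ E]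
    {r : WithTop ℕ∞} {A : E → Matrix l m ℂ} :
    ContDiff ℝ r A ↔ ∀ i j, ContDiff ℝ r fun p => A p i j := by
  refine (contDiff_pi (F' := fun _ => m → ℂ)).trans (forall_congr' fun i => ?_)
  exact contDiff_pi

theorem HasDerivAt.matrix_mul {l m n : Type*} [Fintype m] [Fintype n]
    {A : ℝ → Matrix l m ℂ} {B : ℝ → Matrix m n ℂ}
    {A' : Matrix l m ℂ} {B' : Matrix m n ℂ} {x : ℝ}
    (hA : HasDerivAt A A' x) (hB : HasDerivAt B B' x) :
    HasDerivAt (fun y => A y * B y) (A' * B x + A x * B') x := by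
  rw [Matrix.hasDerivAt_iff] at *
  intro i j
  simp only [Matrix.add_apply, Matrix.mul_apply, ← Finset.sum_add_distrib]
  exact HasDerivAt.fun_sum fun s _ => (hA i s).mul (hB s j)

theorem HasDerivAt.matrix_add {A B : ℝ → Matrix l m ℂ} {A' B' : Matrix l m ℂ} {x : ℝ}
    (hA : HasDerivAt A A' x) (hB : HasDerivAt B B' x) :
    HasDerivAt (fun y => A y + B y) (A' + B') x :=
  HasDerivAt.fun_add hA hB

theorem HasDerivAt.matrix_sub {A B : ℝ → Matrix l m ℂ} {A' B' : Matrix l m ℂ} {x : ℝ}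
    (hA : HasDerivAt A A' x) (hB : HasDerivAt B B' x) :
    HasDerivAt (fun y => A y - B y) (A' - B') x :=
  HasDerivAt.fun_sub hA hB

theorem HasDerivAt.matrix_smul {l m : Type*} [Fintype m]
    {A : ℝ → Matrix l m ℂ} {A' : Matrix l m ℂ} {x : ℝ} (c : ℂ)
    (hA : HasDerivAt A A' x) : HasDerivAt (fun y => c • A y) (c • A') x := by
  rw [Matrix.hasDerivAt_iff] at *
  exact fun i j => (hA i j).const_smul c

theorem HasDerivAt.matrix_conjTranspose {A : ℝ → Matrix l m ℂ} {A' : Matrix l m ℂ} {x : ℝ}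
    (hA : HasDerivAt A A' x) : HasDerivAt (fun y => (A y)ᴴ) A'ᴴ x := by
  rw [Matrix.hasDerivAt_iff] at *
  exact fun i j => (hA j i).star

theorem ContDiff.matrix_mul {E : Type*} [NormedAddCommGroup E] [NormedSpace ℝ E]
    {r : WithTop ℕ∞} {A : E → Matrix l m ℂ} {B : E → Matrix m n ℂ}
    (hA : ContDiff ℝ r A) (hB : ContDiff ℝ r B) : ContDiff ℝ r fun p => A p * B p := by
  rw [Matrix.contDiff_iff] at *
  intro i j
  simp only [Matrix.mul_apply]
  exact ContDiff.sum fun s _ => (hA i s).mul (hB s j)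

theorem ContDiff.matrix_conjTranspose {E : Type*} [NormedAddCommGroup E] [NormedSpace ℝ E]
    {r : WithTop ℕ∞} {A : E → Matrix l m ℂ} (hA : ContDiff ℝ r A) :
    ContDiff ℝ r fun p => (A p)ᴴ := by
  rw [Matrix.contDiff_iff] at *
  intro i j
  exact (starL' ℝ (A := ℂ)).contDiff.comp (hA j i)

/-- If `g' = g U` with `U` skew-Hermitian, then `(g W g⁻¹)' = g (W' + [U, W]) g⁻¹`. -/
theorem HasDerivAt.matrix_conj {g W : ℝ → Matrix n n ℂ} {U W' : Matrix n n ℂ} {x : ℝ}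
    (hg : HasDerivAt g (g x * U) x) (hU : Uᴴ = -U) (hW : HasDerivAt W W' x) :
    HasDerivAt (fun y => g y * W y * (g y)ᴴ)
      (g x * (W' + (U * W x - W x * U)) * (g x)ᴴ) x := by
  convert (hg.matrix_mul hW).matrix_mul hg.matrix_conjTranspose using 1
  rw [conjTranspose_mul, hU]
  noncomm_ring

theorem Matrix.deriv_eq {A : ℝ → Matrix l m ℂ} {A' : Matrix l m ℂ} {x : ℝ}
    (hA : HasDerivAt A A' x) : deriv A x = A' :=
  HasDerivAt.deriv hA

theorem Matrix.hasDerivAt_unique {A : ℝ → Matrix l m ℂ} {A' A'' : Matrix l m ℂ} {x : ℝ}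
    (h' : HasDerivAt A A' x) (h'' : HasDerivAt A A'' x) : A' = A'' :=
  HasDerivAt.unique h' h''

theorem Matrix.hasDerivAt_const (x : ℝ) (A : Matrix l m ℂ) :
    HasDerivAt (fun _ : ℝ => A) 0 x :=
  _root_.hasDerivAt_const x A

theorem Matrix.exists_partials {F : ℝ × ℝ → Matrix l m ℂ} (hF : ContDiff ℝ (⊤ : ℕ∞) F) :
    ∃ Fx Ft Fxt : ℝ × ℝ → Matrix l m ℂ, ContDiff ℝ (⊤ : ℕ∞) Fx ∧ ContDiff ℝ (⊤ : ℕ∞) Ft ∧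
      (∀ x t, HasDerivAt (fun y => F (y, t)) (Fx (x, t)) x) ∧
      (∀ x t, HasDerivAt (fun s => F (x, s)) (Ft (x, t)) t) ∧
      (∀ x t, HasDerivAt (fun s => Fx (x, s)) (Fxt (x, t)) t) ∧
      (∀ x t, HasDerivAt (fun y => Ft (y, t)) (Fxt (x, t)) x) :=
  hF.exists_partials

/-- A matrix function with vanishing derivative and limit `0` at `-∞` vanishes. -/
theorem Matrix.eq_zero_of_hasDerivAt_zero {A : ℝ → Matrix l m ℂ}
    (hA : ∀ x, HasDerivAt A 0 x) (hlim : Tendsto A atBot (nhds 0)) (x : ℝ) : A x = 0 :=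
  eq_zero_of_hasDerivAt_zero_of_tendsto_atBot hA hlim x

end MatrixCalculus

theorem Filter.Tendsto.matrix_mul {α l m n : Type*} [Fintype m] {f : Filter α}
    {A : α → Matrix l m ℂ} {B : α → Matrix m n ℂ} {A₀ : Matrix l m ℂ} {B₀ : Matrix m n ℂ}
    (hA : Tendsto A f (nhds A₀)) (hB : Tendsto B f (nhds B₀)) :
    Tendsto (fun x => A x * B x) f (nhds (A₀ * B₀)) := by
  refine tendsto_pi_nhds.mpr fun i => tendsto_pi_nhds.mpr fun j => ?_
  simp only [Matrix.mul_apply]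
  exact tendsto_finsetSum _ fun s _ => (tendsto_pi_nhds.mp (tendsto_pi_nhds.mp hA i) s).mul
    (tendsto_pi_nhds.mp (tendsto_pi_nhds.mp hB s) j)

section Blocks

variable {m n : Type*} [Fintype m] [Fintype n]

open scoped ComplexOrder in
/-- Elements of `u(n)_a^⊥` are the off-diagonal skew-Hermitian block matrices. -/
theorem eq_fromBlocks_of_mem_uPerp [DecidableEq m] [DecidableEq n]
    {y : Matrix (m ⊕ n) (m ⊕ n) ℂ} {c : ℂ}
    (hy : y ∈ uPerp (c • Matrix.fromBlocks 1 0 0 (-1))) :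
    y = Matrix.fromBlocks 0 y.toBlocks₁₂ (-y.toBlocks₁₂ᴴ) 0 := by
  obtain ⟨hskew, horth⟩ := hy
  rw [← Matrix.fromBlocks_toBlocks y] at hskew horth
  rw [Matrix.fromBlocks_conjTranspose, Matrix.fromBlocks_neg, Matrix.fromBlocks_inj] at hskew
  obtain ⟨h11, -, h12, h22⟩ := hskew
  have hA : y.toBlocks₁₁ = 0 := by
    have h := horth (Matrix.fromBlocks y.toBlocks₁₁ 0 0 0)
      ⟨by simp [Matrix.fromBlocks_conjTranspose, Matrix.fromBlocks_neg, h11],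
        by simp [Matrix.fromBlocks_multiply]⟩
    rw [← Matrix.trace_conjTranspose_mul_self_eq_zero_iff, h11, neg_mul, Matrix.trace_neg]
    simpa [Matrix.fromBlocks_multiply, Matrix.trace] using h
  have hD : y.toBlocks₂₂ = 0 := by
    have h := horth (Matrix.fromBlocks 0 0 0 y.toBlocks₂₂)
      ⟨by simp [Matrix.fromBlocks_conjTranspose, Matrix.fromBlocks_neg, h22],
        by simp [Matrix.fromBlocks_multiply]⟩
    rw [← Matrix.trace_conjTranspose_mul_self_eq_zero_iff, h22, neg_mul, Matrix.trace_neg]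
    simpa [Matrix.fromBlocks_multiply, Matrix.trace] using h
  conv_lhs => rw [← Matrix.fromBlocks_toBlocks y, hA, hD]
  rw [h12, neg_neg]

theorem HasDerivAt.toBlocks₁₁ {A : ℝ → Matrix (m ⊕ n) (m ⊕ n) ℂ}
    {A' : Matrix (m ⊕ n) (m ⊕ n) ℂ} {x : ℝ} (hA : HasDerivAt A A' x) :
    HasDerivAt (fun y => (A y).toBlocks₁₁) A'.toBlocks₁₁ x := by
  rw [Matrix.hasDerivAt_iff] at *
  exact fun i j => hA _ _

theorem HasDerivAt.toBlocks₁₂ {A : ℝ → Matrix (m ⊕ n) (m ⊕ n) ℂ}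
    {A' : Matrix (m ⊕ n) (m ⊕ n) ℂ} {x : ℝ} (hA : HasDerivAt A A' x) :
    HasDerivAt (fun y => (A y).toBlocks₁₂) A'.toBlocks₁₂ x := by
  rw [Matrix.hasDerivAt_iff] at *
  exact fun i j => hA _ _

theorem HasDerivAt.toBlocks₂₂ {A : ℝ → Matrix (m ⊕ n) (m ⊕ n) ℂ}
    {A' : Matrix (m ⊕ n) (m ⊕ n) ℂ} {x : ℝ} (hA : HasDerivAt A A' x) :
    HasDerivAt (fun y => (A y).toBlocks₂₂) A'.toBlocks₂₂ x := by
  rw [Matrix.hasDerivAt_iff] at *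
  exact fun i j => hA _ _

theorem HasDerivAt.matrix_fromBlocks {A : ℝ → Matrix m m ℂ} {B : ℝ → Matrix m n ℂ}
    {C : ℝ → Matrix n m ℂ} {D : ℝ → Matrix n n ℂ} {A' : Matrix m m ℂ} {B' : Matrix m n ℂ}
    {C' : Matrix n m ℂ} {D' : Matrix n n ℂ} {x : ℝ} (hA : HasDerivAt A A' x)
    (hB : HasDerivAt B B' x) (hC : HasDerivAt C C' x) (hD : HasDerivAt D D' x) :
    HasDerivAt (fun y => Matrix.fromBlocks (A y) (B y) (C y) (D y))
      (Matrix.fromBlocks A' B' C' D') x := by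
  rw [Matrix.hasDerivAt_iff] at *
  rintro (i | i) (j | j)
  exacts [hA i j, hB i j, hC i j, hD i j]

theorem Filter.Tendsto.matrix_toBlocks₁₁ {m n α : Type*} {f : Filter α}
    {A : α → Matrix (m ⊕ n) (m ⊕ n) ℂ} (hA : Tendsto A f (nhds 0)) :
    Tendsto (fun x => (A x).toBlocks₁₁) f (nhds 0) :=
  ((continuous_id.matrix_submatrix Sum.inl Sum.inl).tendsto 0).comp hA

theorem Filter.Tendsto.matrix_toBlocks₁₂ {m n α : Type*} {f : Filter α}
    {A : α → Matrix (m ⊕ n) (m ⊕ n) ℂ} (hA : Tendsto A f (nhds 0)) :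
    Tendsto (fun x => (A x).toBlocks₁₂) f (nhds 0) :=
  ((continuous_id.matrix_submatrix Sum.inl Sum.inr).tendsto 0).comp hA

theorem Filter.Tendsto.matrix_toBlocks₂₂ {m n α : Type*} {f : Filter α}
    {A : α → Matrix (m ⊕ n) (m ⊕ n) ℂ} (hA : Tendsto A f (nhds 0)) :
    Tendsto (fun x => (A x).toBlocks₂₂) f (nhds 0) :=
  ((continuous_id.matrix_submatrix Sum.inr Sum.inr).tendsto 0).comp hA

/-- The off-diagonal blocks of `v` are determined by `[v, a] = [a, [u', a] + [u, [u, a]]]` when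
`u` and `u'` are off-diagonal. -/
theorem toBlocks_of_commutator_eq [DecidableEq m] [DecidableEq n]
    {a u u' v : Matrix (m ⊕ n) (m ⊕ n) ℂ} {q q' : Matrix m n ℂ} {r r' : Matrix n m ℂ}
    (ha : a = (Complex.I / 2) • Matrix.fromBlocks 1 0 0 (-1))
    (hu : u = Matrix.fromBlocks 0 q r 0) (hu' : u' = Matrix.fromBlocks 0 q' r' 0)
    (h : v * a - a * v =
      a * (u' * a - a * u' + (u * (u * a - a * u) - (u * a - a * u) * u))
        - (u' * a - a * u' + (u * (u * a - a * u) - (u * a - a * u) * u)) * a) :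
    v.toBlocks₁₂ = Complex.I • q' ∧ v.toBlocks₂₁ = -Complex.I • r' := by
  rw [← Matrix.fromBlocks_toBlocks v] at h
  simp only [hu, hu', ha, Matrix.fromBlocks_multiply, Matrix.fromBlocks_smul,
    sub_eq_add_neg, Matrix.fromBlocks_neg, Matrix.fromBlocks_add, Matrix.fromBlocks_inj] at h
  obtain ⟨-, h12, h21, -⟩ := h
  constructor
  · ext i j
    have e := congrFun (congrFun h12 i) j
    simp at e ⊢
    linear_combination Complex.I * e + (v.toBlocks₁₂ i j - Complex.I * q' i j) * Complex.I_sq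
  · ext i j
    have e := congrFun (congrFun h21 i) j
    simp at e ⊢
    linear_combination -Complex.I * e + (v.toBlocks₂₁ i j + Complex.I * r' i j) * Complex.I_sq

end Blocks

/-- The development map carries the GNLS flow to the MNLS flow:
with `a = (i/2)·diag(I_k, −I_{n−k})`, `g : ℝ² → U(n)` smooth, `u := g⁻¹g_x` valued in
`u(n)_a^⊥`, `u(·,t)` and `(g⁻¹g_t)(·,t)` Schwartz, `g → I` and `g⁻¹g_t → 0` as `x → −∞`,
`γ := g a g⁻¹`, and `q` the upper-right `k×(n−k)` block of `u`: if `γ_t = [γ, γ_xx]` then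
`q_t = i(q_xx + 2qq*q)`. -/
theorem stmt10 (k m : ℕ) (hk : 0 < k) (hm : 0 < m)
    (a : Matrix (Fin k ⊕ Fin m) (Fin k ⊕ Fin m) ℂ)
    (ha : a = (Complex.I / 2) • Matrix.fromBlocks 1 0 0 (-1))
    (g : ℝ → ℝ → Matrix (Fin k ⊕ Fin m) (Fin k ⊕ Fin m) ℂ)
    (hg : ContDiff ℝ (⊤ : ℕ∞) fun p : ℝ × ℝ => g p.1 p.2)
    (hgU : ∀ x t, g x t ∈ Matrix.unitaryGroup (Fin k ⊕ Fin m) ℂ)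
    -- u := g⁻¹ g_x takes values in u(n)_a^⊥
    (u : ℝ → ℝ → Matrix (Fin k ⊕ Fin m) (Fin k ⊕ Fin m) ℂ)
    (hu : ∀ x t, u x t = star (g x t) * deriv (fun y => g y t) x)
    (huP : ∀ x t, u x t ∈ uPerp a)
    -- Schwartz-class assumptions in x, for each t
    (huS : ∀ t, IsSchwartz (fun x => u x t))
    (hgtS : ∀ t, IsSchwartz (fun x => star (g x t) * deriv (fun s => g x s) t))
    -- asymptotic conditions as x → −∞, for each t
    (hglim : ∀ t, Tendsto (fun x => g x t) atBot (nhds 1))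
    (hgtlim : ∀ t, Tendsto (fun x => star (g x t) * deriv (fun s => g x s) t) atBot (nhds 0))
    -- γ := g a g⁻¹ and its partial derivatives
    (γ γx γxx γt : ℝ → ℝ → Matrix (Fin k ⊕ Fin m) (Fin k ⊕ Fin m) ℂ)
    (hγ : ∀ x t, γ x t = g x t * a * star (g x t))
    (hγx : ∀ x t, γx x t = deriv (fun y => γ y t) x)
    (hγxx : ∀ x t, γxx x t = deriv (fun y => γx y t) x)
    (hγt : ∀ x t, γt x t = deriv (fun s => γ x s) t)
    -- γ satisfies the GNLS equation γ_t = [γ, γ_xx]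
    (hGNLS : ∀ x t, γt x t = γ x t * γxx x t - γxx x t * γ x t)
    -- q := the upper-right k×(n−k) block of u, and its partial derivatives
    (q qx qxx qt : ℝ → ℝ → Matrix (Fin k) (Fin m) ℂ)
    (hq : ∀ x t, q x t = (u x t).toBlocks₁₂)
    (hqx : ∀ x t, qx x t = deriv (fun y => q y t) x)
    (hqxx : ∀ x t, qxx x t = deriv (fun y => qx y t) x)
    (hqt : ∀ x t, qt x t = deriv (fun s => q x s) t) :
    -- q satisfies the matrix nonlinear Schrödinger equation
    ∀ x t, qt x t = Complex.I • (qxx x t + (2 : ℂ) • (q x t * (q x t)ᴴ * q x t)) := by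
  obtain ⟨Gx, Gt, Gxt, hGxs, hGts, hgx, hgt, hGxt, hGtx⟩ := Matrix.exists_partials hg
  simp only at hgx hgt
  have hgg (x t) : (g x t)ᴴ * g x t = 1 := Matrix.mem_unitaryGroup_iff'.mp (hgU x t)
  have hgg' (x t) : g x t * (g x t)ᴴ = 1 := Matrix.mem_unitaryGroup_iff.mp (hgU x t)
  -- `V = g⁻¹ g_t`, and smoothness of `u` and `V`
  obtain ⟨V, hV⟩ : ∃ V : ℝ → ℝ → Matrix (Fin k ⊕ Fin m) (Fin k ⊕ Fin m) ℂ,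
      ∀ x t, V x t = (g x t)ᴴ * Gt (x, t) := ⟨_, fun _ _ => rfl⟩
  have hu' (x t) : u x t = (g x t)ᴴ * Gx (x, t) := by
    rw [hu, Matrix.deriv_eq (hgx x t), Matrix.star_eq_conjTranspose]
  have hGx (x t) : Gx (x, t) = g x t * u x t := by
    rw [hu', ← Matrix.mul_assoc, hgg', Matrix.one_mul]
  have hGt (x t) : Gt (x, t) = g x t * V x t := by
    rw [hV, ← Matrix.mul_assoc, hgg', Matrix.one_mul]
  have hus : ContDiff ℝ (⊤ : ℕ∞) fun p : ℝ × ℝ => u p.1 p.2 := by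
    simp only [hu']
    exact hg.matrix_conjTranspose.matrix_mul hGxs
  have hVs : ContDiff ℝ (⊤ : ℕ∞) fun p : ℝ × ℝ => V p.1 p.2 := by
    simp only [hV]
    exact hg.matrix_conjTranspose.matrix_mul hGts
  simp only [hGx] at hgx hGxt
  simp only [hGt] at hgt hGtx
  have hVlim (t) : Tendsto (fun x => V x t) atBot (nhds 0) := by
    refine (hgtlim t).congr fun x => ?_
    rw [Matrix.deriv_eq (hgt x t), Matrix.star_eq_conjTranspose, ← Matrix.mul_assoc, hgg,
      Matrix.one_mul]
  obtain ⟨Ux, Ut, -, hUxs, -, hux, hut, -, -⟩ := Matrix.exists_partials hus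
  obtain ⟨Vx, -, -, -, -, hVx, -, -, -⟩ := Matrix.exists_partials hVs
  obtain ⟨Uxx, -, -, -, -, huxx, -, -, -⟩ := Matrix.exists_partials hUxs
  simp only at hux hut hVx
  have huskew (x t) : (u x t)ᴴ = -u x t := (huP x t).1
  have hVskew (x t) : (V x t)ᴴ = -V x t := by
    have h := (hgt x t).matrix_conjTranspose.matrix_mul (hgt x t)
    simp only [hgg] at h
    have e := Matrix.hasDerivAt_unique (Matrix.hasDerivAt_const t 1) h
    rw [conjTranspose_mul, Matrix.mul_assoc, ← Matrix.mul_assoc _ (g x t),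
      hgg, Matrix.mul_one, Matrix.one_mul] at e
    exact eq_neg_of_add_eq_zero_left e.symm
  -- the zero-curvature equation `u_t = V_x + [u, V]`
  have hcurv (x t) : Ut (x, t) = Vx (x, t) + (u x t * V x t - V x t * u x t) := by
    have e := congrArg (fun M => (g x t)ᴴ * M) <|
      (Matrix.hasDerivAt_unique ((hgt x t).matrix_mul (hut x t)) (hGxt x t)).trans
        (Matrix.hasDerivAt_unique (hGtx x t) ((hgx x t).matrix_mul (hVx x t)))
    simp only [Matrix.mul_add, ← Matrix.mul_assoc, hgg, Matrix.one_mul] at e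
    rw [← sub_eq_zero] at e ⊢
    rw [← e]
    abel
  -- the GNLS equation, conjugated back by `g`
  have hWx (x t) : HasDerivAt (fun y => u y t * a - a * u y t)
      (Ux (x, t) * a - a * Ux (x, t)) x := by
    simpa using ((hux x t).matrix_mul (Matrix.hasDerivAt_const x a)).matrix_sub
      ((Matrix.hasDerivAt_const x a).matrix_mul (hux x t))
  have hγx' (x t) : γx x t = g x t * (u x t * a - a * u x t) * (g x t)ᴴ := by
    rw [hγx]
    simp only [hγ, Matrix.star_eq_conjTranspose]
    simpa using Matrix.deriv_eq
      ((hgx x t).matrix_conj (huskew x t) (Matrix.hasDerivAt_const x a))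
  have hγxx' (x t) : γxx x t = g x t * (Ux (x, t) * a - a * Ux (x, t) +
      (u x t * (u x t * a - a * u x t) - (u x t * a - a * u x t) * u x t)) * (g x t)ᴴ := by
    rw [hγxx]
    simp only [hγx']
    exact Matrix.deriv_eq ((hgx x t).matrix_conj (huskew x t) (hWx x t))
  have hγt' (x t) : γt x t = g x t * (V x t * a - a * V x t) * (g x t)ᴴ := by
    rw [hγt]
    simp only [hγ, Matrix.star_eq_conjTranspose]
    simpa using Matrix.deriv_eq
      ((hgt x t).matrix_conj (hVskew x t) (Matrix.hasDerivAt_const t a))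
  have hgnls (x t) : V x t * a - a * V x t =
      a * (Ux (x, t) * a - a * Ux (x, t) +
          (u x t * (u x t * a - a * u x t) - (u x t * a - a * u x t) * u x t)) -
        (Ux (x, t) * a - a * Ux (x, t) +
          (u x t * (u x t * a - a * u x t) - (u x t * a - a * u x t) * u x t)) * a := by
    have h := hGNLS x t
    rw [hγt', hγ, hγxx', Matrix.star_eq_conjTranspose] at h
    generalize Ux (x, t) * a - a * Ux (x, t) +
      (u x t * (u x t * a - a * u x t) - (u x t * a - a * u x t) * u x t) = Z at h ⊢
    have hmul (M N) : g x t * M * (g x t)ᴴ * (g x t * N * (g x t)ᴴ) =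
        g x t * (M * N) * (g x t)ᴴ := by
      simp only [Matrix.mul_assoc]
      rw [← Matrix.mul_assoc (g x t)ᴴ, hgg, Matrix.one_mul]
    have hcancel (M) : (g x t)ᴴ * (g x t * M * (g x t)ᴴ) * g x t = M := by
      simp only [Matrix.mul_assoc, hgg, Matrix.mul_one]
      rw [← Matrix.mul_assoc, hgg, Matrix.one_mul]
    rw [hmul, hmul, ← Matrix.sub_mul, ← Matrix.mul_sub] at h
    rw [← hcancel (V x t * a - a * V x t), h, hcancel]
  -- passing to blocks
  have hublk (x t) : u x t = Matrix.fromBlocks 0 (q x t) (-(q x t)ᴴ) 0 := by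
    rw [hq]
    exact eq_fromBlocks_of_mem_uPerp (ha ▸ huP x t)
  have hq_x (x t) : HasDerivAt (fun y => q y t) (Ux (x, t)).toBlocks₁₂ x := by
    simpa only [hq] using (hux x t).toBlocks₁₂
  have hUx₁₂ (x t) : (Ux (x, t)).toBlocks₁₂ = qx x t := by
    rw [hqx, Matrix.deriv_eq (hq_x x t)]
  simp only [hUx₁₂] at hq_x
  have hqx_x (x t) : HasDerivAt (fun y => qx y t) (qxx x t) x := by
    have h := (huxx x t).toBlocks₁₂
    simp only [hUx₁₂] at h
    rwa [hqxx, Matrix.deriv_eq h]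
  have hqt' (x t) : qt x t = (Ut (x, t)).toBlocks₁₂ := by
    rw [hqt]
    simp only [hq]
    exact Matrix.deriv_eq (hut x t).toBlocks₁₂
  have hUxblk (x t) : Ux (x, t) = Matrix.fromBlocks 0 (qx x t) (-(qx x t)ᴴ) 0 := by
    have h := hux x t
    simp only [hublk] at h
    refine Matrix.hasDerivAt_unique h <| (Matrix.hasDerivAt_const x 0).matrix_fromBlocks (hq_x x t)
      ?_ (Matrix.hasDerivAt_const x 0)
    simpa using (hq_x x t).matrix_conjTranspose.matrix_smul (-1)
  have hVoff (x t) := toBlocks_of_commutator_eq ha (hublk x t) (hUxblk x t) (hgnls x t)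
  have hVblk (x t) : V x t = Matrix.fromBlocks (V x t).toBlocks₁₁ (Complex.I • qx x t)
      (Complex.I • (qx x t)ᴴ) (V x t).toBlocks₂₂ := by
    conv_lhs => rw [← Matrix.fromBlocks_toBlocks (V x t), (hVoff x t).1, (hVoff x t).2]
    simp
  have hVx₁₂ (x t) : (Vx (x, t)).toBlocks₁₂ = Complex.I • qxx x t := by
    have h := (hVx x t).toBlocks₁₂
    simp only [hVoff] at h
    exact Matrix.hasDerivAt_unique h ((hqx_x x t).matrix_smul Complex.I)
  have hUt₁₁ (x t) : (Ut (x, t)).toBlocks₁₁ = 0 := by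
    have h := (hut x t).toBlocks₁₁
    simp only [hublk, Matrix.toBlocks_fromBlocks₁₁] at h
    exact Matrix.hasDerivAt_unique h (Matrix.hasDerivAt_const t 0)
  have hUt₂₂ (x t) : (Ut (x, t)).toBlocks₂₂ = 0 := by
    have h := (hut x t).toBlocks₂₂
    simp only [hublk, Matrix.toBlocks_fromBlocks₂₂] at h
    exact Matrix.hasDerivAt_unique h (Matrix.hasDerivAt_const t 0)
  have hcurvblk (x t) :
      (Vx (x, t)).toBlocks₁₁ + Complex.I • (qx x t * (q x t)ᴴ + q x t * (qx x t)ᴴ) = 0 ∧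
      qt x t = Complex.I • qxx x t +
        (q x t * (V x t).toBlocks₂₂ - (V x t).toBlocks₁₁ * q x t) ∧
      (Vx (x, t)).toBlocks₂₂ - Complex.I • ((qx x t)ᴴ * q x t + (q x t)ᴴ * qx x t) = 0 := by
    have e := hcurv x t
    rw [hublk, hVblk, ← Matrix.fromBlocks_toBlocks (Ut (x, t)),
      ← Matrix.fromBlocks_toBlocks (Vx (x, t)), hUt₁₁, hUt₂₂, hVx₁₂, ← hqt'] at e
    simp only [Matrix.fromBlocks_multiply, sub_eq_add_neg, Matrix.fromBlocks_neg,
      Matrix.fromBlocks_add, Matrix.fromBlocks_inj] at e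
    obtain ⟨e11, e12, -, e22⟩ := e
    refine ⟨e11.trans ?_ |>.symm, e12.trans ?_, e22.trans ?_ |>.symm⟩
    · simp [add_comm]
    · simp [sub_eq_add_neg]
    · simp only [Matrix.neg_mul, Matrix.smul_mul, Matrix.mul_smul, Matrix.zero_mul,
        Matrix.mul_zero, add_zero, smul_add, smul_neg]
      abel
  have hq_lim (t) : Tendsto (fun x => q x t) atBot (nhds 0) := by
    have h : Tendsto (fun x => u x t) atBot (nhds 0) := (huS t).tendsto_atBot
    simpa only [hq] using h.matrix_toBlocks₁₂
  have hqH_lim (t) : Tendsto (fun x => (q x t)ᴴ) atBot (nhds 0) := by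
    simpa [Function.comp_def] using (continuous_id.matrix_conjTranspose.tendsto 0).comp (hq_lim t)
  have hV₁₁ (x t) : (V x t).toBlocks₁₁ + Complex.I • (q x t * (q x t)ᴴ) = 0 := by
    refine Matrix.eq_zero_of_hasDerivAt_zero
      (A := fun x => (V x t).toBlocks₁₁ + Complex.I • (q x t * (q x t)ᴴ)) (fun x => ?_) ?_ x
    · rw [← (hcurvblk x t).1]
      exact (hVx x t).toBlocks₁₁.matrix_add
        (((hq_x x t).matrix_mul (hq_x x t).matrix_conjTranspose).matrix_smul _)
    · simpa using (hVlim t).matrix_toBlocks₁₁.add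
        (((hq_lim t).matrix_mul (hqH_lim t)).const_smul Complex.I)
  have hV₂₂ (x t) : (V x t).toBlocks₂₂ - Complex.I • ((q x t)ᴴ * q x t) = 0 := by
    refine Matrix.eq_zero_of_hasDerivAt_zero
      (A := fun x => (V x t).toBlocks₂₂ - Complex.I • ((q x t)ᴴ * q x t)) (fun x => ?_) ?_ x
    · rw [← (hcurvblk x t).2.2]
      exact (hVx x t).toBlocks₂₂.matrix_sub
        (((hq_x x t).matrix_conjTranspose.matrix_mul (hq_x x t)).matrix_smul _)
    · simpa using (hVlim t).matrix_toBlocks₂₂.sub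
        (((hqH_lim t).matrix_mul (hq_lim t)).const_smul Complex.I)
  intro x t
  rw [(hcurvblk x t).2.1, eq_neg_of_add_eq_zero_left (hV₁₁ x t), sub_eq_zero.mp (hV₂₂ x t)]
  simp only [Matrix.mul_smul, Matrix.neg_mul, Matrix.smul_mul, sub_neg_eq_add, Matrix.mul_assoc,
    smul_add, two_smul]
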